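/- The Lie superalgebras T and a₀ are isomorphic: the linear map φ: T → a₀ defined by φ(X_i) = L_i − L₀, φ(Y_i) = G_i − G₀, φ(X̄_m^x) = x⊗t^m, φ(Ȳ_m^x) = −x⊗t^mξ (i∈ℤ∖{0}, m∈ℤ, x∈ġ) is a Lie superalgebra isomorphism. -/

import Mathlib

/-!
The algebra `Ū`: the quotient of the universal enveloping algebra of
`g̃ = g ⋉ A` (with `g = s̄ ⋉ (ġ ⊗ A)`) by the ideal generated by
`tⁱ·tʲ − t^{i+j}`, `t⁰ − 1`, `tⁱ·ξ − tⁱξ`, `ξ·ξ`.  It is presented as the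
quotient of the free algebra on the generators `L i, G i, x ⊗ tⁱ, x ⊗ tⁱξ, tⁱ,
tⁱξ` by the supercommutator relations of `g̃`, the linearity relations in
`x ∈ ġ`, and the above ideal relations.
-/

noncomputable section

open Module

/-- Generators: `L i`, `G i`, `E i x = x ⊗ tⁱ`, `F i x = x ⊗ tⁱξ`, `t i = tⁱ`,
`xi i = tⁱξ`. -/
inductive UGen (𝕘 : Type) : Type
  | L : ℤ → UGen 𝕘
  | G : ℤ → UGen 𝕘
  | E : ℤ → 𝕘 → UGen 𝕘
  | F : ℤ → 𝕘 → UGen 𝕘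
  | t : ℤ → UGen 𝕘
  | xi : ℤ → UGen 𝕘

/-- The free algebra on the generators. -/
abbrev UFree (𝕘 : Type) : Type := FreeAlgebra ℂ (UGen 𝕘)

variable {𝕘 : Type} [LieRing 𝕘] [LieAlgebra ℂ 𝕘]

def fL (i : ℤ) : UFree 𝕘 := FreeAlgebra.ι ℂ (UGen.L i)
def fG (i : ℤ) : UFree 𝕘 := FreeAlgebra.ι ℂ (UGen.G i)
def fE (i : ℤ) (x : 𝕘) : UFree 𝕘 := FreeAlgebra.ι ℂ (UGen.E i x)
def fF (i : ℤ) (x : 𝕘) : UFree 𝕘 := FreeAlgebra.ι ℂ (UGen.F i x)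
def ft (i : ℤ) : UFree 𝕘 := FreeAlgebra.ι ℂ (UGen.t i)
def fxi (i : ℤ) : UFree 𝕘 := FreeAlgebra.ι ℂ (UGen.xi i)

/-- The defining relations of `Ū`. -/
inductive URel (𝕘 : Type) [LieRing 𝕘] [LieAlgebra ℂ 𝕘] :
    UFree 𝕘 → UFree 𝕘 → Prop
  -- supercommutator relations of `g`
  | LL (i j : ℤ) : URel 𝕘 (fL i * fL j - fL j * fL i) (((j : ℂ) - (i : ℂ)) • fL (i + j))
  | LG (i j : ℤ) : URel 𝕘 (fL i * fG j - fG j * fL i) (((j : ℂ) - (i : ℂ) / 2) • fG (i + j))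
  | GG (i j : ℤ) : URel 𝕘 (fG i * fG j + fG j * fG i) ((-2 : ℂ) • fL (i + j))
  | LE (i j : ℤ) (x : 𝕘) :
      URel 𝕘 (fL i * fE j x - fE j x * fL i) ((j : ℂ) • fE (i + j) x)
  | LF (i j : ℤ) (x : 𝕘) :
      URel 𝕘 (fL i * fF j x - fF j x * fL i) (((j : ℂ) + (i : ℂ) / 2) • fF (i + j) x)
  | GE (i j : ℤ) (x : 𝕘) :
      URel 𝕘 (fG i * fE j x - fE j x * fG i) ((j : ℂ) • fF (i + j) x)
  | GF (i j : ℤ) (x : 𝕘) :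
      URel 𝕘 (fG i * fF j x + fF j x * fG i) (- fE (i + j) x)
  | EE (i j : ℤ) (x y : 𝕘) :
      URel 𝕘 (fE i x * fE j y - fE j y * fE i x) (fE (i + j) ⁅x, y⁆)
  | FE (i j : ℤ) (x y : 𝕘) :
      URel 𝕘 (fF i x * fE j y - fE j y * fF i x) (fF (i + j) ⁅x, y⁆)
  | FF (i j : ℤ) (x y : 𝕘) :
      URel 𝕘 (fF i x * fF j y + fF j y * fF i x) 0
  -- the action of `g` on `A`
  | Lt (i j : ℤ) : URel 𝕘 (fL i * ft j - ft j * fL i) ((j : ℂ) • ft (i + j))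
  | Lxi (i j : ℤ) :
      URel 𝕘 (fL i * fxi j - fxi j * fL i) (((j : ℂ) + (i : ℂ) / 2) • fxi (i + j))
  | Gt (i j : ℤ) : URel 𝕘 (fG i * ft j - ft j * fG i) ((j : ℂ) • fxi (i + j))
  | Gxi (i j : ℤ) : URel 𝕘 (fG i * fxi j + fxi j * fG i) (- ft (i + j))
  | Et (i j : ℤ) (x : 𝕘) : URel 𝕘 (fE i x * ft j - ft j * fE i x) 0
  | Exi (i j : ℤ) (x : 𝕘) : URel 𝕘 (fE i x * fxi j - fxi j * fE i x) 0
  | Ft (i j : ℤ) (x : 𝕘) : URel 𝕘 (fF i x * ft j - ft j * fF i x) 0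
  | Fxi (i j : ℤ) (x : 𝕘) : URel 𝕘 (fF i x * fxi j + fxi j * fF i x) 0
  -- `A` is (super)commutative
  | tt (i j : ℤ) : URel 𝕘 (ft i * ft j - ft j * ft i) 0
  | txiComm (i j : ℤ) : URel 𝕘 (ft i * fxi j - fxi j * ft i) 0
  | xixi (i j : ℤ) : URel 𝕘 (fxi i * fxi j + fxi j * fxi i) 0
  -- linearity of `x ⊗ tⁱ` and `x ⊗ tⁱξ` in `x`
  | Eadd (i : ℤ) (x y : 𝕘) : URel 𝕘 (fE i (x + y)) (fE i x + fE i y)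
  | Esmul (i : ℤ) (c : ℂ) (x : 𝕘) : URel 𝕘 (fE i (c • x)) (c • fE i x)
  | Fadd (i : ℤ) (x y : 𝕘) : URel 𝕘 (fF i (x + y)) (fF i x + fF i y)
  | Fsmul (i : ℤ) (c : ℂ) (x : 𝕘) : URel 𝕘 (fF i (c • x)) (c • fF i x)
  -- the ideal `I`: `tⁱ·tʲ = t^{i+j}`, `t⁰ = 1`, `tⁱ·ξ = tⁱξ`, `ξ·ξ = 0`
  | tmul (i j : ℤ) : URel 𝕘 (ft i * ft j) (ft (i + j))
  | tone : URel 𝕘 (ft 0) 1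
  | txi (i : ℤ) : URel 𝕘 (ft i * fxi 0) (fxi i)
  | xisq : URel 𝕘 (fxi 0 * fxi 0) 0

/-- The algebra `Ū`. -/
abbrev UBar (𝕘 : Type) [LieRing 𝕘] [LieAlgebra ℂ 𝕘] : Type := RingQuot (URel 𝕘)

/-- Canonical map `UFree 𝕘 → Ū`. -/
def uof : UFree 𝕘 →ₐ[ℂ] UBar 𝕘 := RingQuot.mkAlgHom ℂ (URel 𝕘)

def uL (i : ℤ) : UBar 𝕘 := uof (fL i)
def uG (i : ℤ) : UBar 𝕘 := uof (fG i)
def uE (i : ℤ) (x : 𝕘) : UBar 𝕘 := uof (fE i x)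
def uF (i : ℤ) (x : 𝕘) : UBar 𝕘 := uof (fF i x)
def ut (i : ℤ) : UBar 𝕘 := uof (ft i)
def uxi (i : ℤ) : UBar 𝕘 := uof (fxi i)

/-- `X_i = t^{−i}·L_i + (i/2) t^{−i}ξ·G_i − L₀`. -/
def uX (i : ℤ) : UBar 𝕘 :=
  ut (-i) * uL i + ((i : ℂ) / 2) • (uxi (-i) * uG i) - uL 0

/-- `Y_i = t^{−i}·G_i − 2 t^{−i}ξ·L_i − G₀ + 2 ξ·L₀`. -/
def uY (i : ℤ) : UBar 𝕘 :=
  ut (-i) * uG i - (2 : ℂ) • (uxi (-i) * uL i) - uG 0 + (2 : ℂ) • (uxi 0 * uL 0)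

/-- `X̄_m^x = t^{−m}·(x ⊗ tᵐ) + m t^{−m}ξ·(x ⊗ tᵐξ)`. -/
def uXB (m : ℤ) (x : 𝕘) : UBar 𝕘 :=
  ut (-m) * uE m x + (m : ℂ) • (uxi (-m) * uF m x)

/-- `Ȳ_m^x = t^{−m}ξ·(x ⊗ tᵐ) − t^{−m}·(x ⊗ tᵐξ)`. -/
def uYB (m : ℤ) (x : 𝕘) : UBar 𝕘 :=
  uxi (-m) * uE m x - ut (-m) * uF m x

/-- The subspace `T ⊆ Ū` spanned by the `X_i, Y_i (i ≠ 0)` and `X̄_m^x, Ȳ_m^x`. -/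
def TSpan (𝕘 : Type) [LieRing 𝕘] [LieAlgebra ℂ 𝕘] : Submodule ℂ (UBar 𝕘) :=
  Submodule.span ℂ
    ({u | ∃ i : ℤ, i ≠ 0 ∧ u = uX i} ∪ {u | ∃ i : ℤ, i ≠ 0 ∧ u = uY i}
      ∪ {u | ∃ (m : ℤ) (x : 𝕘), u = uXB m x} ∪ {u | ∃ (m : ℤ) (x : 𝕘), u = uYB m x})

/-! ### The Lie superalgebra `g` and its subalgebra `a₀`

The underlying space of `g = s̄ ⋉ (ġ ⊗ A)` is realised concretely:
the four components record the coefficients of the `L_i`, the `G_i`, the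
`x ⊗ tᵐ` and the `x ⊗ tᵐξ` respectively. -/

/-- Underlying space of `g`. -/
abbrev GCar (𝕘 : Type) [LieRing 𝕘] [LieAlgebra ℂ 𝕘] : Type :=
  ((ℤ →₀ ℂ) × (ℤ →₀ ℂ)) × ((ℤ →₀ 𝕘) × (ℤ →₀ 𝕘))

/-- The basis element `L i` of `g`. -/
def eL (i : ℤ) : GCar 𝕘 := ((Finsupp.single i 1, 0), (0, 0))

/-- The basis element `G i` of `g`. -/
def eG (i : ℤ) : GCar 𝕘 := ((0, Finsupp.single i 1), (0, 0))

/-- The element `x ⊗ tᵐ` of `g`. -/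
def eE (m : ℤ) (x : 𝕘) : GCar 𝕘 := ((0, 0), (Finsupp.single m x, 0))

/-- The element `x ⊗ tᵐξ` of `g`. -/
def eF (m : ℤ) (x : 𝕘) : GCar 𝕘 := ((0, 0), (0, Finsupp.single m x))

/-- Sum-of-coefficients functional on `ℤ →₀ ℂ`. -/
def coeffSum : (ℤ →₀ ℂ) →ₗ[ℂ] ℂ :=
  Finsupp.lsum ℂ fun _ : ℤ => (LinearMap.id : ℂ →ₗ[ℂ] ℂ)

/-- The subalgebra `a₀ = (t−1)s̄ ⋉ (ġ ⊗ A)` of `g`: it consists of the elements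
whose `L`- and `G`-coefficients sum to zero, i.e. it is spanned by
`{L_i − L₀, G_i − G₀, x ⊗ tᵐ, x ⊗ tᵐξ}`. -/
def a0Sub (𝕘 : Type) [LieRing 𝕘] [LieAlgebra ℂ 𝕘] : Submodule ℂ (GCar 𝕘) :=
  ((LinearMap.ker coeffSum).prod (LinearMap.ker coeffSum)).prod ⊤

/-- Families of coefficients for a representation of `Ū` on `V`-valued formal series in `t, s`
(even) and `ξ, η` (odd): the components belong to `1, ξ, η, ξη`, and the arguments are the exponents
of `t` and `s`. The algebra `A` acts through `t, ξ`, the algebra `ġ ⊗ A` through `s, η`. -/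
abbrev RepSpace (V : Type) : Type :=
  (ℤ → ℤ → V) × (ℤ → ℤ → V) × (ℤ → ℤ → V) × (ℤ → ℤ → V)

def repL (V : Type) [AddCommGroup V] [Module ℂ V] (i : ℤ) : Module.End ℂ (RepSpace V) where
  toFun f :=
    (fun a b => ((a : ℂ) - i) • f.1 (a - i) b + ((b : ℂ) - i) • f.1 a (b - i),
     fun a b => ((a : ℂ) - i / 2) • f.2.1 (a - i) b + ((b : ℂ) - i) • f.2.1 a (b - i),
     fun a b => ((a : ℂ) - i) • f.2.2.1 (a - i) b + ((b : ℂ) - i / 2) • f.2.2.1 a (b - i),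
     fun a b => ((a : ℂ) - i / 2) • f.2.2.2 (a - i) b
       + ((b : ℂ) - i / 2) • f.2.2.2 a (b - i))
  map_add' f g := by ext a b <;> simp <;> module
  map_smul' c f := by ext a b <;> simp <;> module

lemma repL_apply (V : Type) [AddCommGroup V] [Module ℂ V] (i : ℤ) (f : RepSpace V) (a b : ℤ) :
    (repL V i f).1 a b = ((a : ℂ) - i) • f.1 (a - i) b + ((b : ℂ) - i) • f.1 a (b - i) ∧
    (repL V i f).2.1 a b = ((a : ℂ) - i / 2) • f.2.1 (a - i) b + ((b : ℂ) - i) • f.2.1 a (b - i) ∧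
    (repL V i f).2.2.1 a b =
      ((a : ℂ) - i) • f.2.2.1 (a - i) b + ((b : ℂ) - i / 2) • f.2.2.1 a (b - i) ∧
    (repL V i f).2.2.2 a b =
      ((a : ℂ) - i / 2) • f.2.2.2 (a - i) b + ((b : ℂ) - i / 2) • f.2.2.2 a (b - i) :=
  ⟨rfl, rfl, rfl, rfl⟩

def repG (V : Type) [AddCommGroup V] [Module ℂ V] (i : ℤ) : Module.End ℂ (RepSpace V) where
  toFun f :=
    (fun a b => - f.2.1 (a - i) b - f.2.2.1 a (b - i),
     fun a b => ((a : ℂ) - i) • f.1 (a - i) b + f.2.2.2 a (b - i),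
     fun a b => - f.2.2.2 (a - i) b + ((b : ℂ) - i) • f.1 a (b - i),
     fun a b => ((a : ℂ) - i) • f.2.2.1 (a - i) b - ((b : ℂ) - i) • f.2.1 a (b - i))
  map_add' f g := by ext a b <;> simp <;> module
  map_smul' c f := by ext a b <;> simp <;> module

lemma repG_apply (V : Type) [AddCommGroup V] [Module ℂ V] (i : ℤ) (f : RepSpace V) (a b : ℤ) :
    (repG V i f).1 a b = - f.2.1 (a - i) b - f.2.2.1 a (b - i) ∧
    (repG V i f).2.1 a b = ((a : ℂ) - i) • f.1 (a - i) b + f.2.2.2 a (b - i) ∧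
    (repG V i f).2.2.1 a b = - f.2.2.2 (a - i) b + ((b : ℂ) - i) • f.1 a (b - i) ∧
    (repG V i f).2.2.2 a b = ((a : ℂ) - i) • f.2.2.1 (a - i) b - ((b : ℂ) - i) • f.2.1 a (b - i) :=
  ⟨rfl, rfl, rfl, rfl⟩

def repE (i : ℤ) (x : 𝕘) : Module.End ℂ (RepSpace 𝕘) where
  toFun f :=
    (fun a b => ⁅x, f.1 a (b - i)⁆, fun a b => ⁅x, f.2.1 a (b - i)⁆,
     fun a b => ⁅x, f.2.2.1 a (b - i)⁆, fun a b => ⁅x, f.2.2.2 a (b - i)⁆)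
  map_add' f g := by ext a b <;> simp
  map_smul' c f := by ext a b <;> simp

lemma repE_apply (i : ℤ) (x : 𝕘) (f : RepSpace 𝕘) (a b : ℤ) :
    (repE i x f).1 a b = ⁅x, f.1 a (b - i)⁆ ∧
    (repE i x f).2.1 a b = ⁅x, f.2.1 a (b - i)⁆ ∧
    (repE i x f).2.2.1 a b = ⁅x, f.2.2.1 a (b - i)⁆ ∧
    (repE i x f).2.2.2 a b = ⁅x, f.2.2.2 a (b - i)⁆ :=
  ⟨rfl, rfl, rfl, rfl⟩

def repF (i : ℤ) (x : 𝕘) : Module.End ℂ (RepSpace 𝕘) where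
  toFun f :=
    (0, 0, fun a b => ⁅x, f.1 a (b - i)⁆, fun a b => - ⁅x, f.2.1 a (b - i)⁆)
  map_add' f g := by ext a b <;> simp <;> abel
  map_smul' c f := by ext a b <;> simp [-lie_skew]

lemma repF_apply (i : ℤ) (x : 𝕘) (f : RepSpace 𝕘) (a b : ℤ) :
    (repF i x f).1 a b = 0 ∧
    (repF i x f).2.1 a b = 0 ∧
    (repF i x f).2.2.1 a b = ⁅x, f.1 a (b - i)⁆ ∧
    (repF i x f).2.2.2 a b = - ⁅x, f.2.1 a (b - i)⁆ :=
  ⟨rfl, rfl, rfl, rfl⟩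

def rept (V : Type) [AddCommGroup V] [Module ℂ V] (i : ℤ) : Module.End ℂ (RepSpace V) where
  toFun f :=
    (fun a b => f.1 (a - i) b, fun a b => f.2.1 (a - i) b,
     fun a b => f.2.2.1 (a - i) b, fun a b => f.2.2.2 (a - i) b)
  map_add' _ _ := rfl
  map_smul' _ _ := rfl

lemma rept_apply (V : Type) [AddCommGroup V] [Module ℂ V] (i : ℤ) (f : RepSpace V) (a b : ℤ) :
    (rept V i f).1 a b = f.1 (a - i) b ∧
    (rept V i f).2.1 a b = f.2.1 (a - i) b ∧
    (rept V i f).2.2.1 a b = f.2.2.1 (a - i) b ∧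
    (rept V i f).2.2.2 a b = f.2.2.2 (a - i) b :=
  ⟨rfl, rfl, rfl, rfl⟩

def repxi (V : Type) [AddCommGroup V] [Module ℂ V] (i : ℤ) : Module.End ℂ (RepSpace V) where
  toFun f :=
    (0, fun a b => f.1 (a - i) b, 0, fun a b => f.2.2.1 (a - i) b)
  map_add' f g := by ext a b <;> simp
  map_smul' c f := by ext a b <;> simp

lemma repxi_apply (V : Type) [AddCommGroup V] [Module ℂ V] (i : ℤ) (f : RepSpace V) (a b : ℤ) :
    (repxi V i f).1 a b = 0 ∧
    (repxi V i f).2.1 a b = f.1 (a - i) b ∧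
    (repxi V i f).2.2.1 a b = 0 ∧
    (repxi V i f).2.2.2 a b = f.2.2.1 (a - i) b :=
  ⟨rfl, rfl, rfl, rfl⟩

def repGen : UGen 𝕘 → Module.End ℂ (RepSpace 𝕘)
  | .L i => repL 𝕘 i
  | .G i => repG 𝕘 i
  | .E i x => repE i x
  | .F i x => repF i x
  | .t i => rept 𝕘 i
  | .xi i => repxi 𝕘 i

set_option maxHeartbeats 1600000 in
lemma repGen_rel {u v : UFree 𝕘} (h : URel 𝕘 u v) :
    FreeAlgebra.lift ℂ repGen u = FreeAlgebra.lift ℂ repGen v := by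
  cases h <;>
  simp only [fL, fG, fE, fF, ft, fxi, map_sub, map_add, map_mul, map_smul, map_neg, map_zero,
    map_one, FreeAlgebra.lift_ι_apply, repGen] <;>
  refine LinearMap.ext fun f => ?_ <;>
  ext a b <;>
  simp only [LinearMap.sub_apply, LinearMap.add_apply, LinearMap.smul_apply, LinearMap.neg_apply,
    LinearMap.zero_apply, Module.End.mul_apply, Module.End.one_apply, Prod.fst_sub, Prod.snd_sub,
    Prod.fst_add, Prod.snd_add, Prod.smul_fst, Prod.smul_snd, Prod.fst_neg, Prod.snd_neg,
    Prod.fst_zero, Prod.snd_zero, Pi.sub_apply, Pi.add_apply, Pi.smul_apply, Pi.neg_apply,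
    Pi.zero_apply, repL_apply, repG_apply, repE_apply, repF_apply, rept_apply, repxi_apply,
    Int.sub_sub, Int.add_comm, Int.cast_add, Int.cast_sub, lie_add, lie_sub, lie_neg, lie_zero,
    lie_smul, add_lie, smul_lie, lie_lie, sub_zero, smul_zero, neg_zero, add_zero] <;>
  module

def repU (𝕘 : Type) [LieRing 𝕘] [LieAlgebra ℂ 𝕘] : UBar 𝕘 →ₐ[ℂ] Module.End ℂ (RepSpace 𝕘) :=
  RingQuot.liftAlgHom ℂ ⟨FreeAlgebra.lift ℂ repGen, fun _ _ h => repGen_rel h⟩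

lemma uof_rel {u v : UFree 𝕘} (h : URel 𝕘 u v) : uof u = uof v :=
  RingQuot.mkAlgHom_rel ℂ h

lemma uL_mul_uL (i j : ℤ) :
    (uL i * uL j : UBar 𝕘) = (uL j * uL i) + ((j : ℂ) - (i : ℂ)) • uL (i + j) := by
  have h := uof_rel (URel.LL (𝕘 := 𝕘) i j)
  simp only [map_sub, map_mul, map_smul] at h
  exact sub_eq_iff_eq_add'.1 h

lemma uL_mul_uG (i j : ℤ) :
    (uL i * uG j : UBar 𝕘) = (uG j * uL i) + ((j : ℂ) - (i : ℂ) / 2) • uG (i + j) := by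
  have h := uof_rel (URel.LG (𝕘 := 𝕘) i j)
  simp only [map_sub, map_mul, map_smul] at h
  exact sub_eq_iff_eq_add'.1 h

lemma uG_mul_uG (i j : ℤ) :
    (uG i * uG j : UBar 𝕘) = (-1 : ℂ) • (uG j * uG i) + (-2 : ℂ) • uL (i + j) := by
  have h := uof_rel (URel.GG (𝕘 := 𝕘) i j)
  simp only [map_add, map_mul, map_smul] at h
  refine (eq_sub_of_add_eq h).trans ?_
  simp only [uL, uG]
  module

lemma uL_mul_uE (i j : ℤ) (y : 𝕘) :
    (uL i * uE j y : UBar 𝕘) = (uE j y * uL i) + (j : ℂ) • uE (i + j) y := by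
  have h := uof_rel (URel.LE (𝕘 := 𝕘) i j y)
  simp only [map_sub, map_mul, map_smul] at h
  exact sub_eq_iff_eq_add'.1 h

lemma uL_mul_uF (i j : ℤ) (y : 𝕘) :
    (uL i * uF j y : UBar 𝕘) = (uF j y * uL i) + ((j : ℂ) + (i : ℂ) / 2) • uF (i + j) y := by
  have h := uof_rel (URel.LF (𝕘 := 𝕘) i j y)
  simp only [map_sub, map_mul, map_smul] at h
  exact sub_eq_iff_eq_add'.1 h

lemma uG_mul_uE (i j : ℤ) (y : 𝕘) :
    (uG i * uE j y : UBar 𝕘) = (uE j y * uG i) + (j : ℂ) • uF (i + j) y := by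
  have h := uof_rel (URel.GE (𝕘 := 𝕘) i j y)
  simp only [map_sub, map_mul, map_smul] at h
  exact sub_eq_iff_eq_add'.1 h

lemma uG_mul_uF (i j : ℤ) (y : 𝕘) :
    (uG i * uF j y : UBar 𝕘) = (-1 : ℂ) • (uF j y * uG i) + (-1 : ℂ) • uE (i + j) y := by
  have h := uof_rel (URel.GF (𝕘 := 𝕘) i j y)
  simp only [map_add, map_mul, map_neg] at h
  refine (eq_sub_of_add_eq h).trans ?_
  simp only [uG, uE, uF]
  module

lemma uE_mul_uE (i j : ℤ) (x y : 𝕘) :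
    (uE i x * uE j y : UBar 𝕘) = (uE j y * uE i x) + uE (i + j) ⁅x, y⁆ := by
  have h := uof_rel (URel.EE (𝕘 := 𝕘) i j x y)
  simp only [map_sub, map_mul] at h
  exact sub_eq_iff_eq_add'.1 h

lemma uF_mul_uE (i j : ℤ) (x y : 𝕘) :
    (uF i x * uE j y : UBar 𝕘) = (uE j y * uF i x) + uF (i + j) ⁅x, y⁆ := by
  have h := uof_rel (URel.FE (𝕘 := 𝕘) i j x y)
  simp only [map_sub, map_mul] at h
  exact sub_eq_iff_eq_add'.1 h

lemma uF_mul_uF (i j : ℤ) (x y : 𝕘) :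
    (uF i x * uF j y : UBar 𝕘) = (-1 : ℂ) • (uF j y * uF i x) := by
  have h := uof_rel (URel.FF (𝕘 := 𝕘) i j x y)
  simp only [map_add, map_mul, map_zero] at h
  refine (eq_neg_of_add_eq_zero_left h).trans ?_
  simp only [uF]
  module

lemma uL_mul_ut (i j : ℤ) :
    (uL i * ut j : UBar 𝕘) = (ut j * uL i) + (j : ℂ) • ut (i + j) := by
  have h := uof_rel (URel.Lt (𝕘 := 𝕘) i j)
  simp only [map_sub, map_mul, map_smul] at h
  exact sub_eq_iff_eq_add'.1 h

lemma uL_mul_uxi (i j : ℤ) :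
    (uL i * uxi j : UBar 𝕘) = (uxi j * uL i) + ((j : ℂ) + (i : ℂ) / 2) • uxi (i + j) := by
  have h := uof_rel (URel.Lxi (𝕘 := 𝕘) i j)
  simp only [map_sub, map_mul, map_smul] at h
  exact sub_eq_iff_eq_add'.1 h

lemma uG_mul_ut (i j : ℤ) :
    (uG i * ut j : UBar 𝕘) = (ut j * uG i) + (j : ℂ) • uxi (i + j) := by
  have h := uof_rel (URel.Gt (𝕘 := 𝕘) i j)
  simp only [map_sub, map_mul, map_smul] at h
  exact sub_eq_iff_eq_add'.1 h

lemma uG_mul_uxi (i j : ℤ) :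
    (uG i * uxi j : UBar 𝕘) = (-1 : ℂ) • (uxi j * uG i) + (-1 : ℂ) • ut (i + j) := by
  have h := uof_rel (URel.Gxi (𝕘 := 𝕘) i j)
  simp only [map_add, map_mul, map_neg] at h
  refine (eq_sub_of_add_eq h).trans ?_
  simp only [uG, ut, uxi]
  module

lemma uE_mul_ut (i j : ℤ) (x : 𝕘) :
    (uE i x * ut j : UBar 𝕘) = (ut j * uE i x) := by
  have h := uof_rel (URel.Et (𝕘 := 𝕘) i j x)
  simp only [map_sub, map_mul, map_zero] at h
  exact sub_eq_zero.1 h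

lemma uE_mul_uxi (i j : ℤ) (x : 𝕘) :
    (uE i x * uxi j : UBar 𝕘) = (uxi j * uE i x) := by
  have h := uof_rel (URel.Exi (𝕘 := 𝕘) i j x)
  simp only [map_sub, map_mul, map_zero] at h
  exact sub_eq_zero.1 h

lemma uF_mul_ut (i j : ℤ) (x : 𝕘) :
    (uF i x * ut j : UBar 𝕘) = (ut j * uF i x) := by
  have h := uof_rel (URel.Ft (𝕘 := 𝕘) i j x)
  simp only [map_sub, map_mul, map_zero] at h
  exact sub_eq_zero.1 h

lemma uF_mul_uxi (i j : ℤ) (x : 𝕘) :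
    (uF i x * uxi j : UBar 𝕘) = (-1 : ℂ) • (uxi j * uF i x) := by
  have h := uof_rel (URel.Fxi (𝕘 := 𝕘) i j x)
  simp only [map_add, map_mul, map_zero] at h
  refine (eq_neg_of_add_eq_zero_left h).trans ?_
  simp only [uF, uxi]
  module

lemma uG_zero_mul_uG_zero : (uG 0 * uG 0 : UBar 𝕘) = (-1 : ℂ) • uL 0 := by
  have h := uG_mul_uG (𝕘 := 𝕘) 0 0
  rw [add_zero] at h
  have h' : (2 : ℂ) • (uG 0 * uG 0 : UBar 𝕘) = (2 : ℂ) • (-1 : ℂ) • uL 0 := by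
    linear_combination (norm := module) h
  exact smul_right_injective _ two_ne_zero h'

lemma ut_mul_ut (i j : ℤ) : (ut i * ut j : UBar 𝕘) = ut (i + j) := by
  have h := uof_rel (URel.tmul (𝕘 := 𝕘) i j)
  simp only [map_mul] at h
  exact h

lemma ut_zero : (ut 0 : UBar 𝕘) = 1 := by
  have h := uof_rel (URel.tone (𝕘 := 𝕘))
  simp only [map_one] at h
  exact h

lemma ut_mul_uxi_zero (i : ℤ) : (ut i * uxi 0 : UBar 𝕘) = uxi i := by
  have h := uof_rel (URel.txi (𝕘 := 𝕘) i)
  simp only [map_mul] at h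
  exact h

lemma uxi_mul_ut_comm (i j : ℤ) : (uxi i * ut j : UBar 𝕘) = ut j * uxi i := by
  have h := uof_rel (URel.txiComm (𝕘 := 𝕘) j i)
  simp only [map_sub, map_mul, map_zero] at h
  exact (sub_eq_zero.1 h).symm

lemma ut_mul_uxi (i j : ℤ) : (ut i * uxi j : UBar 𝕘) = uxi (i + j) := by
  rw [← ut_mul_uxi_zero j, ← mul_assoc, ut_mul_ut, ut_mul_uxi_zero]

lemma uxi_mul_ut (i j : ℤ) : (uxi i * ut j : UBar 𝕘) = uxi (i + j) := by
  rw [uxi_mul_ut_comm, ut_mul_uxi, add_comm]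

lemma uxi_mul_uxi (i j : ℤ) : (uxi i * uxi j : UBar 𝕘) = 0 := by
  have h : (uxi 0 * uxi 0 : UBar 𝕘) = 0 := by
    have h := uof_rel (URel.xisq (𝕘 := 𝕘))
    simp only [map_mul, map_zero] at h
    exact h
  rw [← ut_mul_uxi_zero i, ← ut_mul_uxi_zero j, mul_assoc, ← mul_assoc (uxi 0),
    uxi_mul_ut_comm, mul_assoc, h, mul_zero, mul_zero]

lemma uE_add (i : ℤ) (x y : 𝕘) : uE i (x + y) = uE i x + uE i y := by
  have h := uof_rel (URel.Eadd i x y)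
  simp only [map_add] at h
  exact h

lemma uE_smul (i : ℤ) (c : ℂ) (x : 𝕘) : uE i (c • x) = c • uE i x := by
  have h := uof_rel (URel.Esmul i c x)
  simp only [map_smul] at h
  exact h

lemma uF_add (i : ℤ) (x y : 𝕘) : uF i (x + y) = uF i x + uF i y := by
  have h := uof_rel (URel.Fadd i x y)
  simp only [map_add] at h
  exact h

lemma uF_smul (i : ℤ) (c : ℂ) (x : 𝕘) : uF i (c • x) = c • uF i x := by
  have h := uof_rel (URel.Fsmul i c x)
  simp only [map_smul] at h
  exact h

lemma uL_mul_ut_assoc (i j : ℤ) (z : UBar 𝕘) :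
    uL i * (ut j * z) = ut j * (uL i * z) + (j : ℂ) • (ut (i + j) * z) := by
  rw [← mul_assoc, uL_mul_ut, add_mul, smul_mul_assoc, mul_assoc]

lemma uL_mul_uxi_assoc (i j : ℤ) (z : UBar 𝕘) :
    uL i * (uxi j * z) = uxi j * (uL i * z) + ((j : ℂ) + (i : ℂ) / 2) • (uxi (i + j) * z) := by
  rw [← mul_assoc, uL_mul_uxi, add_mul, smul_mul_assoc, mul_assoc]

lemma uG_mul_ut_assoc (i j : ℤ) (z : UBar 𝕘) :
    uG i * (ut j * z) = ut j * (uG i * z) + (j : ℂ) • (uxi (i + j) * z) := by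
  rw [← mul_assoc, uG_mul_ut, add_mul, smul_mul_assoc, mul_assoc]

lemma uG_mul_uxi_assoc (i j : ℤ) (z : UBar 𝕘) :
    uG i * (uxi j * z) = (-1 : ℂ) • (uxi j * (uG i * z)) + (-1 : ℂ) • (ut (i + j) * z) := by
  rw [← mul_assoc, uG_mul_uxi, add_mul, smul_mul_assoc, smul_mul_assoc, mul_assoc]

lemma uE_mul_ut_assoc (i j : ℤ) (x : 𝕘) (z : UBar 𝕘) :
    uE i x * (ut j * z) = ut j * (uE i x * z) := by
  rw [← mul_assoc, uE_mul_ut, mul_assoc]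

lemma uE_mul_uxi_assoc (i j : ℤ) (x : 𝕘) (z : UBar 𝕘) :
    uE i x * (uxi j * z) = uxi j * (uE i x * z) := by
  rw [← mul_assoc, uE_mul_uxi, mul_assoc]

lemma uF_mul_ut_assoc (i j : ℤ) (x : 𝕘) (z : UBar 𝕘) :
    uF i x * (ut j * z) = ut j * (uF i x * z) := by
  rw [← mul_assoc, uF_mul_ut, mul_assoc]

lemma uF_mul_uxi_assoc (i j : ℤ) (x : 𝕘) (z : UBar 𝕘) :
    uF i x * (uxi j * z) = (-1 : ℂ) • (uxi j * (uF i x * z)) := by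
  rw [← mul_assoc, uF_mul_uxi, smul_mul_assoc, mul_assoc]

lemma ut_mul_ut_assoc (i j : ℤ) (z : UBar 𝕘) :
    ut i * (ut j * z) = ut (i + j) * z := by
  rw [← mul_assoc, ut_mul_ut]

lemma ut_mul_uxi_assoc (i j : ℤ) (z : UBar 𝕘) :
    ut i * (uxi j * z) = uxi (i + j) * z := by
  rw [← mul_assoc, ut_mul_uxi]

lemma uxi_mul_ut_assoc (i j : ℤ) (z : UBar 𝕘) :
    uxi i * (ut j * z) = uxi (i + j) * z := by
  rw [← mul_assoc, uxi_mul_ut]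

lemma uxi_mul_uxi_assoc (i j : ℤ) (z : UBar 𝕘) :
    uxi i * (uxi j * z) = 0 := by
  rw [← mul_assoc, uxi_mul_uxi, zero_mul]

lemma uF_lie_swap (x y : 𝕘) (i : ℤ) : uF i ⁅x, y⁆ = (-1 : ℂ) • uF i ⁅y, x⁆ := by
  rw [← uF_smul, neg_one_smul, lie_skew]

lemma uX_commutator_uX (i j : ℤ) :
    (uX i * uX j - uX j * uX i : UBar 𝕘)
      = ((j : ℂ) - i) • uX (i + j) + (i : ℂ) • uX i - (j : ℂ) • uX j := by
  simp only [uX, mul_add, add_mul, mul_sub, sub_mul, smul_mul_assoc, mul_smul_comm, mul_assoc,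
    smul_zero, Int.add_zero, Int.zero_add, Int.neg_add_cancel_left, ut_mul_ut_assoc,
    ut_mul_uxi_assoc, uxi_mul_ut_assoc, uxi_mul_uxi_assoc, uL_mul_ut_assoc, uL_mul_uxi_assoc,
    uG_mul_ut_assoc, uG_mul_uxi_assoc, uL_mul_uL i j, uL_mul_uL i 0, uL_mul_uL j 0, uL_mul_uG,
    uG_mul_uG i j]
  simp only [Int.cast_neg, Int.cast_add, Int.cast_zero, Int.neg_add, Int.add_comm]
  module

lemma uX_commutator_uY (i j : ℤ) :
    (uX i * uY j - uY j * uX i : UBar 𝕘)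
      = ((j : ℂ) - i / 2) • uY (i + j) + ((i : ℂ) / 2) • uY i - (j : ℂ) • uY j := by
  simp only [uX, uY, mul_add, add_mul, mul_sub, sub_mul, smul_mul_assoc, mul_smul_comm, mul_assoc,
    smul_zero, Int.add_zero, Int.zero_add, Int.neg_add_cancel_left, Int.add_left_neg,
    ut_mul_ut_assoc, ut_mul_uxi_assoc, uxi_mul_ut_assoc, uxi_mul_uxi_assoc, uL_mul_ut_assoc,
    uL_mul_uxi_assoc, uG_mul_ut_assoc, uG_mul_uxi_assoc, uL_mul_uL i j, uL_mul_uL i 0,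
    uL_mul_uL j 0, uL_mul_uG, uG_mul_uG i j, uG_mul_uG i 0]
  simp only [Int.cast_neg, Int.cast_zero, Int.neg_add, Int.add_comm]
  module

lemma uY_anticommutator_uY (i j : ℤ) :
    (uY i * uY j + uY j * uY i : UBar 𝕘)
      = (2 : ℂ) • uX i + (2 : ℂ) • uX j - (2 : ℂ) • uX (i + j) := by
  simp only [uX, uY, mul_add, add_mul, mul_sub, sub_mul, smul_mul_assoc, mul_smul_comm, mul_assoc,
    smul_zero, one_mul, ut_zero, Int.add_zero, Int.zero_add, Int.neg_add_cancel_left,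
    Int.add_left_neg, ut_mul_ut_assoc, ut_mul_uxi_assoc, uxi_mul_ut_assoc, uxi_mul_uxi_assoc,
    uL_mul_ut_assoc, uL_mul_uxi_assoc, uG_mul_ut_assoc, uG_mul_uxi_assoc, uL_mul_uL i j,
    uL_mul_uL i 0, uL_mul_uL j 0, uL_mul_uG, uG_mul_uG i j, uG_mul_uG i 0, uG_mul_uG j 0,
    uG_zero_mul_uG_zero]
  simp only [Int.cast_neg, Int.cast_add, Int.cast_zero, Int.neg_add, Int.add_comm]
  module

lemma uX_commutator_uXB (i m : ℤ) (x : 𝕘) :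
    (uX i * uXB m x - uXB m x * uX i : UBar 𝕘)
      = (m : ℂ) • uXB (i + m) x - (m : ℂ) • uXB m x := by
  simp only [uX, uXB, mul_add, add_mul, mul_sub, sub_mul, smul_mul_assoc, mul_smul_comm, mul_assoc,
    smul_zero, Int.zero_add, Int.neg_add_cancel_left, ut_mul_ut_assoc, ut_mul_uxi_assoc,
    uxi_mul_ut_assoc, uxi_mul_uxi_assoc, uL_mul_ut_assoc, uL_mul_uxi_assoc, uG_mul_ut_assoc,
    uG_mul_uxi_assoc, uE_mul_ut_assoc, uE_mul_uxi_assoc, uF_mul_ut_assoc, uF_mul_uxi_assoc,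
    uL_mul_uE, uL_mul_uF, uG_mul_uE, uG_mul_uF]
  simp only [Int.cast_neg, Int.cast_add, Int.cast_zero, Int.neg_add, Int.add_comm]
  module

lemma uX_commutator_uYB (i m : ℤ) (x : 𝕘) :
    (uX i * uYB m x - uYB m x * uX i : UBar 𝕘)
      = ((m : ℂ) + i / 2) • uYB (i + m) x - (m : ℂ) • uYB m x := by
  simp only [uX, uYB, mul_add, add_mul, mul_sub, sub_mul, smul_mul_assoc, mul_smul_comm, mul_assoc,
    smul_zero, Int.zero_add, Int.neg_add_cancel_left, ut_mul_ut_assoc, ut_mul_uxi_assoc,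
    uxi_mul_ut_assoc, uxi_mul_uxi_assoc, uL_mul_ut_assoc, uL_mul_uxi_assoc, uG_mul_ut_assoc,
    uG_mul_uxi_assoc, uE_mul_ut_assoc, uE_mul_uxi_assoc, uF_mul_ut_assoc, uF_mul_uxi_assoc,
    uL_mul_uE, uL_mul_uF, uG_mul_uE, uG_mul_uF]
  simp only [Int.cast_neg, Int.cast_zero, Int.neg_add, Int.add_comm]
  module

lemma uY_commutator_uXB (i m : ℤ) (x : 𝕘) :
    (uY i * uXB m x - uXB m x * uY i : UBar 𝕘)
      = (m : ℂ) • uYB m x - (m : ℂ) • uYB (i + m) x := by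
  simp only [uY, uXB, uYB, mul_add, add_mul, mul_sub, sub_mul, smul_mul_assoc, mul_smul_comm,
    mul_assoc, smul_zero, Int.add_zero, Int.zero_add, Int.neg_add_cancel_left, ut_mul_ut_assoc,
    ut_mul_uxi_assoc, uxi_mul_ut_assoc, uxi_mul_uxi_assoc, uL_mul_ut_assoc, uL_mul_uxi_assoc,
    uG_mul_ut_assoc, uG_mul_uxi_assoc, uE_mul_ut_assoc, uE_mul_uxi_assoc, uF_mul_ut_assoc,
    uF_mul_uxi_assoc, uL_mul_uE, uL_mul_uF, uG_mul_uE, uG_mul_uF]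
  simp only [Int.cast_neg, Int.neg_add, Int.add_comm]
  module

lemma uY_anticommutator_uYB (i m : ℤ) (x : 𝕘) :
    (uY i * uYB m x + uYB m x * uY i : UBar 𝕘)
      = uXB (i + m) x - uXB m x := by
  simp only [uY, uXB, uYB, mul_add, add_mul, mul_sub, sub_mul, smul_mul_assoc, mul_smul_comm,
    mul_assoc, smul_zero, Int.add_zero, Int.zero_add, Int.neg_add_cancel_left, ut_mul_ut_assoc,
    ut_mul_uxi_assoc, uxi_mul_ut_assoc, uxi_mul_uxi_assoc, uL_mul_ut_assoc, uL_mul_uxi_assoc,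
    uG_mul_ut_assoc, uG_mul_uxi_assoc, uE_mul_ut_assoc, uE_mul_uxi_assoc, uF_mul_ut_assoc,
    uF_mul_uxi_assoc, uL_mul_uE, uL_mul_uF, uG_mul_uE, uG_mul_uF]
  simp only [Int.cast_neg, Int.cast_add, Int.cast_zero, Int.neg_add, Int.add_comm]
  module

lemma uXB_commutator_uXB (m n : ℤ) (x y : 𝕘) :
    (uXB m x * uXB n y - uXB n y * uXB m x : UBar 𝕘)
      = uXB (m + n) ⁅x, y⁆ := by
  simp only [uXB, mul_add, add_mul, smul_mul_assoc, mul_smul_comm, mul_assoc, smul_zero,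
    ut_mul_ut_assoc, ut_mul_uxi_assoc, uxi_mul_ut_assoc, uxi_mul_uxi_assoc, uE_mul_ut_assoc,
    uE_mul_uxi_assoc, uF_mul_ut_assoc, uF_mul_uxi_assoc, uE_mul_uE m n x y, uF_mul_uE,
    uF_mul_uF m n x y, uF_lie_swap y x]
  simp only [Int.cast_add, Int.neg_add, Int.add_comm]
  module

lemma uXB_commutator_uYB (m n : ℤ) (x y : 𝕘) :
    (uXB m x * uYB n y - uYB n y * uXB m x : UBar 𝕘)
      = uYB (m + n) ⁅x, y⁆ := by
  simp only [uXB, uYB, mul_add, add_mul, mul_sub, sub_mul, smul_mul_assoc, mul_smul_comm, mul_assoc,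
    ut_mul_ut_assoc, ut_mul_uxi_assoc, uxi_mul_ut_assoc, uxi_mul_uxi_assoc, uE_mul_ut_assoc,
    uE_mul_uxi_assoc, uF_mul_ut_assoc, uF_mul_uxi_assoc, uE_mul_uE m n x y, uF_mul_uE,
    uF_mul_uF m n x y, uF_lie_swap y x]
  simp only [Int.neg_add, Int.add_comm]
  module

lemma uYB_anticommutator_uYB (m n : ℤ) (x y : 𝕘) :
    (uYB m x * uYB n y + uYB n y * uYB m x : UBar 𝕘)
      = 0 := by
  simp only [uYB, mul_add, mul_sub, sub_mul, mul_smul_comm, mul_assoc, ut_mul_ut_assoc,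
    ut_mul_uxi_assoc, uxi_mul_ut_assoc, uxi_mul_uxi_assoc, uE_mul_ut_assoc, uE_mul_uxi_assoc,
    uF_mul_ut_assoc, uF_mul_uxi_assoc, uE_mul_uE m n x y, uF_mul_uE, uF_mul_uF m n x y,
    uF_lie_swap y x]
  simp only [Int.add_comm]
  module

lemma submodule_eq_top_of_mem {S : Submodule ℂ (GCar 𝕘)} (hL : ∀ i, eL i ∈ S)
    (hG : ∀ i, eG i ∈ S) (hE : ∀ m x, eE m x ∈ S) (hF : ∀ m x, eF m x ∈ S) : S = ⊤ := by
  rw [eq_top_iff]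
  rintro ⟨⟨a, b⟩, c, d⟩ -
  have ha : ((a, 0), (0, 0)) ∈ S := by
    induction a using Finsupp.induction_linear with
    | zero => exact S.zero_mem
    | add f g hf hg => simpa using S.add_mem hf hg
    | single i r => simpa [eL] using S.smul_mem r (hL i)
  have hb : ((0, b), (0, 0)) ∈ S := by
    induction b using Finsupp.induction_linear with
    | zero => exact S.zero_mem
    | add f g hf hg => simpa using S.add_mem hf hg
    | single i r => simpa [eG] using S.smul_mem r (hG i)
  have hc : ((0, 0), (c, 0)) ∈ S := by
    induction c using Finsupp.induction_linear with
    | zero => exact S.zero_mem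
    | add f g hf hg => simpa using S.add_mem hf hg
    | single m x => exact hE m x
  have hd : ((0, 0), (0, d)) ∈ S := by
    induction d using Finsupp.induction_linear with
    | zero => exact S.zero_mem
    | add f g hf hg => simpa using S.add_mem hf hg
    | single m x => exact hF m x
  simpa using S.add_mem (S.add_mem ha hb) (S.add_mem hc hd)

lemma linearMap_ext_of_generators {M : Type*} [AddCommMonoid M] [Module ℂ M]
    {f g : GCar 𝕘 →ₗ[ℂ] M} (hL : ∀ i, f (eL i) = g (eL i)) (hG : ∀ i, f (eG i) = g (eG i))
    (hE : ∀ m x, f (eE m x) = g (eE m x)) (hF : ∀ m x, f (eF m x) = g (eF m x)) : f = g :=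
  LinearMap.eqLocus_eq_top.1 (submodule_eq_top_of_mem hL hG hE hF)

lemma uX_zero : (uX 0 : UBar 𝕘) = 0 := by
  simp [uX, ut_zero]

lemma uY_zero : (uY 0 : UBar 𝕘) = 0 := by
  simp only [uY, neg_zero, ut_zero, one_mul]
  module

def uXBLin (𝕘 : Type) [LieRing 𝕘] [LieAlgebra ℂ 𝕘] (m : ℤ) : 𝕘 →ₗ[ℂ] UBar 𝕘 where
  toFun := uXB m
  map_add' x y := by
    simp only [uXB, uE_add, uF_add, mul_add]
    module
  map_smul' c x := by
    simp only [uXB, uE_smul, uF_smul, mul_smul_comm, RingHom.id_apply]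
    module

def uYBLin (𝕘 : Type) [LieRing 𝕘] [LieAlgebra ℂ 𝕘] (m : ℤ) : 𝕘 →ₗ[ℂ] UBar 𝕘 where
  toFun := uYB m
  map_add' x y := by
    simp only [uYB, uE_add, uF_add, mul_add]
    module
  map_smul' c x := by
    simp only [uYB, uE_smul, uF_smul, mul_smul_comm, RingHom.id_apply]
    module

/-- The linear map `g → Ū` which restricts to the inverse of `φ` on `a₀`. -/
def psi (𝕘 : Type) [LieRing 𝕘] [LieAlgebra ℂ 𝕘] : GCar 𝕘 →ₗ[ℂ] UBar 𝕘 :=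
  ((Finsupp.linearCombination ℂ uX).coprod (Finsupp.linearCombination ℂ uY)).coprod
    ((Finsupp.lsum ℂ (uXBLin 𝕘)).coprod (-Finsupp.lsum ℂ (uYBLin 𝕘)))

lemma psi_eL (i : ℤ) : psi 𝕘 (eL i) = uX i := by
  simp [psi, eL]

lemma psi_eG (i : ℤ) : psi 𝕘 (eG i) = uY i := by
  simp [psi, eG]

lemma psi_eE (m : ℤ) (x : 𝕘) : psi 𝕘 (eE m x) = uXB m x := by
  simp only [psi, eE, LinearMap.coprod_apply, map_zero, Finsupp.lsum_single, zero_add, add_zero]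
  rfl

lemma psi_eF (m : ℤ) (x : 𝕘) : psi 𝕘 (eF m x) = -uYB m x := by
  simp only [psi, eF, LinearMap.coprod_apply, map_zero, LinearMap.neg_apply,
    Finsupp.lsum_single, zero_add]
  rfl

lemma psi_eL_sub (i : ℤ) : psi 𝕘 (eL i - eL 0) = uX i := by
  rw [map_sub, psi_eL, psi_eL, uX_zero, sub_zero]

lemma psi_eG_sub (i : ℤ) : psi 𝕘 (eG i - eG 0) = uY i := by
  rw [map_sub, psi_eG, psi_eG, uY_zero, sub_zero]

lemma uX_mem_TSpan (i : ℤ) : uX i ∈ TSpan 𝕘 := by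
  rcases eq_or_ne i 0 with rfl | hi
  · rw [uX_zero]
    exact zero_mem _
  · exact Submodule.subset_span (Or.inl (Or.inl (Or.inl ⟨i, hi, rfl⟩)))

lemma uY_mem_TSpan (i : ℤ) : uY i ∈ TSpan 𝕘 := by
  rcases eq_or_ne i 0 with rfl | hi
  · rw [uY_zero]
    exact zero_mem _
  · exact Submodule.subset_span (Or.inl (Or.inl (Or.inr ⟨i, hi, rfl⟩)))

lemma uXB_mem_TSpan (m : ℤ) (x : 𝕘) : uXB m x ∈ TSpan 𝕘 :=
  Submodule.subset_span (Or.inl (Or.inr ⟨m, x, rfl⟩))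

lemma uYB_mem_TSpan (m : ℤ) (x : 𝕘) : uYB m x ∈ TSpan 𝕘 :=
  Submodule.subset_span (Or.inr ⟨m, x, rfl⟩)

lemma psi_mem_TSpan (g : GCar 𝕘) : psi 𝕘 g ∈ TSpan 𝕘 := by
  have h : (TSpan 𝕘).comap (psi 𝕘) = ⊤ := by
    refine submodule_eq_top_of_mem (fun i => ?_) (fun i => ?_) (fun m x => ?_) (fun m x => ?_)
    · rw [Submodule.mem_comap, psi_eL]
      exact uX_mem_TSpan i
    · rw [Submodule.mem_comap, psi_eG]
      exact uY_mem_TSpan i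
    · rw [Submodule.mem_comap, psi_eE]
      exact uXB_mem_TSpan m x
    · rw [Submodule.mem_comap, psi_eF]
      exact neg_mem (uYB_mem_TSpan m x)
  exact (Submodule.eq_top_iff'.1 h) g

lemma coeffSum_single (i : ℤ) (c : ℂ) : coeffSum (Finsupp.single i c) = c :=
  Finsupp.lsum_single ..

lemma eL_sub_mem_a0Sub (i : ℤ) : eL i - eL 0 ∈ a0Sub 𝕘 := by
  simp [a0Sub, eL, coeffSum_single, Submodule.mem_prod]

lemma eG_sub_mem_a0Sub (i : ℤ) : eG i - eG 0 ∈ a0Sub 𝕘 := by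
  simp [a0Sub, eG, coeffSum_single, Submodule.mem_prod]

lemma eE_mem_a0Sub (m : ℤ) (x : 𝕘) : eE m x ∈ a0Sub 𝕘 := by
  simp [a0Sub, eE, Submodule.mem_prod]

lemma eF_mem_a0Sub (m : ℤ) (x : 𝕘) : eF m x ∈ a0Sub 𝕘 := by
  simp [a0Sub, eF, Submodule.mem_prod]

lemma map_psi_a0Sub : (a0Sub 𝕘).map (psi 𝕘) = TSpan 𝕘 := by
  refine le_antisymm ?_ (Submodule.span_le.2 ?_)
  · rintro _ ⟨g, -, rfl⟩
    exact psi_mem_TSpan g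
  · rintro _ (((⟨i, -, rfl⟩ | ⟨i, -, rfl⟩) | ⟨m, x, rfl⟩) | ⟨m, x, rfl⟩)
    · exact ⟨_, eL_sub_mem_a0Sub i, psi_eL_sub i⟩
    · exact ⟨_, eG_sub_mem_a0Sub i, psi_eG_sub i⟩
    · exact ⟨_, eE_mem_a0Sub m x, psi_eE m x⟩
    · exact ⟨_, neg_mem (eF_mem_a0Sub m x), by rw [map_neg, psi_eF, neg_neg]⟩

lemma repU_apply_generators (i : ℤ) (x : 𝕘) :
    repU 𝕘 (uL i) = repL 𝕘 i ∧ repU 𝕘 (uG i) = repG 𝕘 i ∧ repU 𝕘 (uE i x) = repE i x ∧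
      repU 𝕘 (uF i x) = repF i x ∧ repU 𝕘 (ut i) = rept 𝕘 i ∧ repU 𝕘 (uxi i) = repxi 𝕘 i := by
  simp only [uL, uG, uE, uF, ut, uxi, fL, fG, fE, fF, ft, fxi, repU, uof,
    RingQuot.liftAlgHom_mkAlgHom_apply, FreeAlgebra.lift_ι_apply, repGen, and_self]

/-- The vector `1 ⊗ (sⁿ ⊗ y)`. -/
def monomialVec (n : ℤ) (y : 𝕘) : RepSpace 𝕘 :=
  (fun a b => if a = 0 ∧ b = n then y else 0, 0, 0, 0)

/-- The coefficient of `t^{-k} s^{n+k}` in `u · (1 ⊗ sⁿ y)`. -/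
def evenCoeff (k n : ℤ) (y : 𝕘) : UBar 𝕘 →ₗ[ℂ] 𝕘 where
  toFun u := (repU 𝕘 u (monomialVec n y)).1 (-k) (n + k)
  map_add' u v := by simp
  map_smul' c u := by simp

/-- The coefficient of `t^{-k} s^{n+k} η` in `u · (1 ⊗ sⁿ y)`. -/
def oddCoeff (k n : ℤ) (y : 𝕘) : UBar 𝕘 →ₗ[ℂ] 𝕘 where
  toFun u := (repU 𝕘 u (monomialVec n y)).2.2.1 (-k) (n + k)
  map_add' u v := by simp
  map_smul' c u := by simp

def evenSymbol (k n : ℤ) (y : 𝕘) : GCar 𝕘 →ₗ[ℂ] 𝕘 where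
  toFun a := ((n : ℂ) * (a.1.1 k - if k = 0 then coeffSum a.1.1 else 0)) • y + ⁅a.2.1 k, y⁆
  map_add' a b := by
    split_ifs <;>
      simp only [Prod.fst_add, Prod.snd_add, Finsupp.add_apply, map_add, add_lie] <;>
      module
  map_smul' c a := by
    split_ifs <;>
      simp only [Prod.smul_fst, Prod.smul_snd, Finsupp.smul_apply, map_smul, smul_lie,
        smul_eq_mul, RingHom.id_apply] <;>
      module

def oddSymbol (k n : ℤ) (y : 𝕘) : GCar 𝕘 →ₗ[ℂ] 𝕘 where
  toFun a := ((n : ℂ) * (a.1.2 k - if k = 0 then coeffSum a.1.2 else 0)) • y + ⁅a.2.2 k, y⁆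
  map_add' a b := by
    split_ifs <;>
      simp only [Prod.fst_add, Prod.snd_add, Finsupp.add_apply, map_add, add_lie] <;>
      module
  map_smul' c a := by
    split_ifs <;>
      simp only [Prod.smul_fst, Prod.smul_snd, Finsupp.smul_apply, map_smul, smul_lie,
        smul_eq_mul, RingHom.id_apply] <;>
      module

lemma evenCoeff_psi (k n : ℤ) (y : 𝕘) (g : GCar 𝕘) :
    evenCoeff k n y (psi 𝕘 g) = evenSymbol k n y g := by
  refine LinearMap.congr_fun (f := evenCoeff k n y ∘ₗ psi 𝕘) (linearMap_ext_of_generators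
    (fun i => ?_) (fun i => ?_) (fun m x => ?_) (fun m x => ?_)) g
  · rw [LinearMap.comp_apply, psi_eL]
    rcases eq_or_ne k i with rfl | hi <;> rcases eq_or_ne k 0 with rfl | hk <;>
      simp [neg_add_eq_zero, Finsupp.single_apply, eq_comm, evenCoeff, evenSymbol, uX, eL,
        coeffSum_single, repU_apply_generators _ (0 : 𝕘), repL_apply, rept_apply, repxi_apply,
        monomialVec, *]
    rw [if_neg fun h => hi h.1.symm, if_neg hi.symm]
    module
  · rw [LinearMap.comp_apply, psi_eG]
    simp [evenCoeff, evenSymbol, uY, eG, repU_apply_generators _ (0 : 𝕘), repG_apply, rept_apply,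
      repxi_apply, monomialVec]
  · rw [LinearMap.comp_apply, psi_eE]
    rcases eq_or_ne k m with rfl | hm <;>
      simp [neg_add_eq_zero, evenCoeff, evenSymbol, uXB, eE, repU_apply_generators _ (0 : 𝕘),
        repU_apply_generators, repE_apply, rept_apply, repxi_apply, monomialVec, *]
  · rw [LinearMap.comp_apply, psi_eF]
    simp [evenCoeff, evenSymbol, uYB, eF, repU_apply_generators _ (0 : 𝕘), repU_apply_generators,
      repF_apply, rept_apply, repxi_apply, monomialVec]

lemma oddCoeff_psi (k n : ℤ) (y : 𝕘) (g : GCar 𝕘) :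
    oddCoeff k n y (psi 𝕘 g) = oddSymbol k n y g := by
  refine LinearMap.congr_fun (f := oddCoeff k n y ∘ₗ psi 𝕘) (linearMap_ext_of_generators
    (fun i => ?_) (fun i => ?_) (fun m x => ?_) (fun m x => ?_)) g
  · rw [LinearMap.comp_apply, psi_eL]
    simp [oddCoeff, oddSymbol, uX, eL, repU_apply_generators _ (0 : 𝕘), repL_apply, rept_apply,
      repxi_apply, monomialVec]
  · rw [LinearMap.comp_apply, psi_eG]
    rcases eq_or_ne k i with rfl | hi <;> rcases eq_or_ne k 0 with rfl | hk <;>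
      simp [neg_add_eq_zero, Finsupp.single_apply, eq_comm, oddCoeff, oddSymbol, uY, eG,
        coeffSum_single, repU_apply_generators _ (0 : 𝕘), repG_apply, rept_apply, repxi_apply,
        monomialVec, *]
    rw [if_neg fun h => hi h.1.symm, if_neg hi.symm]
    module
  · rw [LinearMap.comp_apply, psi_eE]
    simp [oddCoeff, oddSymbol, uXB, eE, repU_apply_generators _ (0 : 𝕘), repU_apply_generators,
      repE_apply, rept_apply, repxi_apply, monomialVec]
  · rw [LinearMap.comp_apply, psi_eF]
    rcases eq_or_ne k m with rfl | hm <;>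
      simp [neg_add_eq_zero, oddCoeff, oddSymbol, uYB, eF, repU_apply_generators _ (0 : 𝕘),
        repU_apply_generators, repF_apply, rept_apply, repxi_apply, monomialVec, *]

lemma eq_zero_of_forall_smul_add_lie_eq_zero [LieAlgebra.IsSimple ℂ 𝕘] {c : ℂ} {x : 𝕘}
    (h : ∀ (n : ℤ) (y : 𝕘), ((n : ℂ) * c) • y + ⁅x, y⁆ = 0) : c = 0 ∧ x = 0 := by
  have hx : ∀ y : 𝕘, ⁅x, y⁆ = 0 := fun y => by simpa using h 0 y
  refine ⟨?_, ?_⟩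
  · have : Nontrivial 𝕘 := by
      by_contra hnt
      rw [not_nontrivial_iff_subsingleton] at hnt
      exact LieAlgebra.IsSimple.non_abelian ℂ (L := 𝕘) ⟨fun _ _ => Subsingleton.elim _ _⟩
    obtain ⟨y, hy⟩ := exists_ne (0 : 𝕘)
    simpa [hx, hy] using h 1 y
  · have hc : x ∈ LieAlgebra.center ℂ 𝕘 := (LieModule.mem_maxTrivSubmodule _ _ _ _).2
      fun y => by rw [← lie_skew, hx, neg_zero]
    simpa [LieAlgebra.center_eq_bot] using hc

lemma eq_zero_of_psi_eq_zero [LieAlgebra.IsSimple ℂ 𝕘] {a : GCar 𝕘} (ha : a ∈ a0Sub 𝕘)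
    (h : psi 𝕘 a = 0) : a = 0 := by
  obtain ⟨⟨hl, hg⟩, -⟩ := ha
  have hl : coeffSum a.1.1 = 0 := hl
  have hg : coeffSum a.1.2 = 0 := hg
  have heven (k : ℤ) : a.1.1 k = 0 ∧ a.2.1 k = 0 :=
    eq_zero_of_forall_smul_add_lie_eq_zero fun n y => by
      simpa [h, evenSymbol, hl] using (evenCoeff_psi k n y a).symm
  have hodd (k : ℤ) : a.1.2 k = 0 ∧ a.2.2 k = 0 :=
    eq_zero_of_forall_smul_add_lie_eq_zero fun n y => by
      simpa [h, oddSymbol, hg] using (oddCoeff_psi k n y a).symm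
  exact Prod.ext (Prod.ext (Finsupp.ext fun k => (heven k).1) (Finsupp.ext fun k => (hodd k).1))
    (Prod.ext (Finsupp.ext fun k => (heven k).2) (Finsupp.ext fun k => (hodd k).2))

lemma psi_injOn [LieAlgebra.IsSimple ℂ 𝕘] : Set.InjOn (psi 𝕘) (a0Sub 𝕘) := fun a ha b hb h =>
  sub_eq_zero.1 <| eq_zero_of_psi_eq_zero (sub_mem ha hb) (by rw [map_sub, h, sub_self])

lemma mul_neg_uYB (u : UBar 𝕘) (m : ℤ) (x : 𝕘) : u * -uYB m x = (-1 : ℂ) • (u * uYB m x) := by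
  rw [← mul_smul_comm]
  congr 1

lemma neg_uYB_mul (m : ℤ) (x : 𝕘) (u : UBar 𝕘) : -uYB m x * u = (-1 : ℂ) • (uYB m x * u) := by
  rw [← smul_mul_assoc]
  congr 1

/-- **Statement 13.** The Lie superalgebras `T` and `a₀` are isomorphic: the
linear map `φ : T → a₀` with `φ(X_i) = L_i − L₀`, `φ(Y_i) = G_i − G₀`,
`φ(X̄_m^x) = x ⊗ tᵐ`, `φ(Ȳ_m^x) = −x ⊗ tᵐξ` is a Lie superalgebra isomorphism.
(It is encoded by its inverse `ψ : a₀ → T ⊆ Ū`, a linear map on `g` restricting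
to a bijection `a₀ → T` which carries the brackets of `a₀` to the
supercommutators of `Ū`.) -/
theorem T_isomorphic_to_a0
    (𝕘 : Type) [LieRing 𝕘] [LieAlgebra ℂ 𝕘] [FiniteDimensional ℂ 𝕘]
    [LieAlgebra.IsSimple ℂ 𝕘] :
    ∃ ψ : GCar 𝕘 →ₗ[ℂ] UBar 𝕘,
      (∀ i : ℤ, ψ (eL i) = uX i) ∧
      (∀ i : ℤ, ψ (eG i) = uY i) ∧
      (∀ (m : ℤ) (x : 𝕘), ψ (eE m x) = uXB m x) ∧
      (∀ (m : ℤ) (x : 𝕘), ψ (eF m x) = - uYB m x) ∧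
      Set.InjOn ψ (a0Sub 𝕘) ∧
      ψ '' (a0Sub 𝕘) = (TSpan 𝕘 : Set (UBar 𝕘)) ∧
      -- `ψ` carries the brackets of `a₀` to supercommutators in `Ū`:
      (∀ i j : ℤ, i ≠ 0 → j ≠ 0 →
        ψ (eL i - eL 0) * ψ (eL j - eL 0) - ψ (eL j - eL 0) * ψ (eL i - eL 0)
          = ψ (((j : ℂ) - (i : ℂ)) • (eL (i + j) - eL 0)
              + (i : ℂ) • (eL i - eL 0) - (j : ℂ) • (eL j - eL 0)) ∧
        ψ (eL i - eL 0) * ψ (eG j - eG 0) - ψ (eG j - eG 0) * ψ (eL i - eL 0)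
          = ψ (((j : ℂ) - (i : ℂ) / 2) • (eG (i + j) - eG 0)
              + ((i : ℂ) / 2) • (eG i - eG 0) - (j : ℂ) • (eG j - eG 0)) ∧
        ψ (eG i - eG 0) * ψ (eG j - eG 0) + ψ (eG j - eG 0) * ψ (eG i - eG 0)
          = ψ ((2 : ℂ) • (eL i - eL 0) + (2 : ℂ) • (eL j - eL 0)
              - (2 : ℂ) • (eL (i + j) - eL 0))) ∧
      (∀ (i m : ℤ) (x : 𝕘), i ≠ 0 →
        ψ (eL i - eL 0) * ψ (eE m x) - ψ (eE m x) * ψ (eL i - eL 0)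
          = ψ ((m : ℂ) • eE (i + m) x - (m : ℂ) • eE m x) ∧
        ψ (eL i - eL 0) * ψ (eF m x) - ψ (eF m x) * ψ (eL i - eL 0)
          = ψ (((m : ℂ) + (i : ℂ) / 2) • eF (i + m) x - (m : ℂ) • eF m x) ∧
        ψ (eG i - eG 0) * ψ (eE m x) - ψ (eE m x) * ψ (eG i - eG 0)
          = ψ ((m : ℂ) • eF (i + m) x - (m : ℂ) • eF m x) ∧
        ψ (eG i - eG 0) * ψ (eF m x) + ψ (eF m x) * ψ (eG i - eG 0)
          = ψ (eE m x - eE (i + m) x)) ∧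
      (∀ (m n : ℤ) (x y : 𝕘),
        ψ (eE m x) * ψ (eE n y) - ψ (eE n y) * ψ (eE m x) = ψ (eE (m + n) ⁅x, y⁆) ∧
        ψ (eE m x) * ψ (eF n y) - ψ (eF n y) * ψ (eE m x) = ψ (eF (m + n) ⁅x, y⁆) ∧
        ψ (eF m x) * ψ (eF n y) + ψ (eF n y) * ψ (eF m x) = 0) := by
  refine ⟨psi 𝕘, psi_eL, psi_eG, psi_eE, psi_eF, psi_injOn, ?_, fun i j _ _ => ⟨?_, ?_, ?_⟩,
    fun i m x _ => ⟨?_, ?_, ?_, ?_⟩, fun m n x y => ⟨?_, ?_, ?_⟩⟩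
  · rw [← Submodule.map_coe, map_psi_a0Sub]
  · simp only [map_add (psi 𝕘), map_sub (psi 𝕘), map_smul, psi_eL, uX_zero, sub_zero,
      uX_commutator_uX]
  · simp only [map_add (psi 𝕘), map_sub (psi 𝕘), map_smul, psi_eL, psi_eG, uX_zero, uY_zero,
      sub_zero, uX_commutator_uY]
  · simp only [map_add (psi 𝕘), map_sub (psi 𝕘), map_smul, psi_eL, psi_eG, uX_zero, uY_zero,
      sub_zero, uY_anticommutator_uY]
  · simp only [map_sub (psi 𝕘), map_smul, psi_eL, psi_eE, uX_zero, sub_zero, uX_commutator_uXB]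
  · rw [psi_eL_sub]
    simp only [map_sub (psi 𝕘), map_smul, psi_eF, mul_neg_uYB, neg_uYB_mul]
    linear_combination (norm := module) (-1 : ℂ) • uX_commutator_uYB i m x
  · rw [psi_eG_sub]
    simp only [map_sub (psi 𝕘), map_smul, psi_eE, psi_eF, uY_commutator_uXB]
    module
  · rw [psi_eG_sub]
    simp only [map_sub (psi 𝕘), psi_eE, psi_eF, mul_neg_uYB, neg_uYB_mul]
    linear_combination (norm := module) (-1 : ℂ) • uY_anticommutator_uYB i m x
  · simp only [psi_eE, uXB_commutator_uXB]
  · simp only [psi_eE, psi_eF, mul_neg_uYB, neg_uYB_mul]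
    linear_combination (norm := module) (-1 : ℂ) • uXB_commutator_uYB m n x y
  · simp only [psi_eF, mul_neg_uYB, neg_uYB_mul]
    linear_combination (norm := module) uYB_anticommutator_uYB m n x y
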